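/- (ℓ¹-contraction for the implicit method.) Let u, v, h, g : ℤ^d → ℝ be absolutely summable sequences such that u solves one implicit step with data h and v solves one implicit step with data g. Then Σ_{α∈ℤ^d} |u_α − v_α| ≤ Σ_{α∈ℤ^d} |h_α − g_α|. -/

import Mathlib

open MeasureTheory Set

noncomputable section

abbrev Ed (d : ℕ) := EuclideanSpace ℝ (Fin d)

def cell (d : ℕ) (dx : ℝ) (α : Fin d → ℤ) : Set (Ed d) :=
  {x | ∀ i, dx * (α i : ℝ) < x i ∧ x i < dx * (α i : ℝ) + dx}

def ind (d : ℕ) (S : Set (Ed d)) : Ed d → ℝ :=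
  S.indicator fun _ => 1

def gam (d : ℕ) (dx : ℝ) (μ : Measure (Ed d)) (l : Fin d) : ℝ :=
  - ∫ z in {z : Ed d | dx / 2 < ‖z‖ ∧ ‖z‖ ≤ 1}, z l ∂μ

def Dup (d : ℕ) (dx : ℝ) (μ : Measure (Ed d)) (l : Fin d) (φ : Ed d → ℝ) (x : Ed d) : ℝ :=
  if 0 < gam d dx μ l then (φ (x + EuclideanSpace.single l dx) - φ x) / dx
  else (φ x - φ (x - EuclideanSpace.single l dx)) / dx

def Glow (d : ℕ) (dx : ℝ) (μ : Measure (Ed d)) (α β : Fin d → ℤ) : ℝ :=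
  (dx ^ d)⁻¹ *
    ∫ x in cell d dx α, ∫ z in {z : Ed d | dx / 2 < ‖z‖},
      (ind d (cell d dx β) (x + z) - ind d (cell d dx β) x) ∂μ

def Gup (d : ℕ) (dx : ℝ) (μ : Measure (Ed d)) (α β : Fin d → ℤ) : ℝ :=
  (dx ^ d)⁻¹ *
    ∑ l : Fin d, gam d dx μ l * ∫ x in cell d dx α, Dup d dx μ l (ind d (cell d dx β)) x

def Gw (d : ℕ) (dx : ℝ) (μ : Measure (Ed d)) (α β : Fin d → ℤ) : ℝ :=
  Glow d dx μ α β + Gup d dx μ α β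

def GsplitLow (d : ℕ) (dx r : ℝ) (μ : Measure (Ed d)) (α β : Fin d → ℤ) : ℝ :=
  (dx ^ d)⁻¹ *
    ∫ x in cell d dx α, ∫ z in {z : Ed d | dx / 2 < ‖z‖ ∧ ‖z‖ ≤ r},
      (ind d (cell d dx β) (x + z) - ind d (cell d dx β) x) ∂μ

def GsplitHigh (d : ℕ) (dx r : ℝ) (μ : Measure (Ed d)) (α β : Fin d → ℤ) : ℝ :=
  (dx ^ d)⁻¹ *
      ∫ x in cell d dx α, ∫ z in {z : Ed d | r < ‖z‖},
        (ind d (cell d dx β) (x + z) - ind d (cell d dx β) x) ∂μ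
    + Gup d dx μ α β

def Aok (A : ℝ → ℝ) (LA : ℝ) : Prop :=
  Monotone A ∧ (∀ a b : ℝ, |A a - A b| ≤ LA * |a - b|) ∧ A 0 = 0

def SolvesImplicitStep (d : ℕ) (dx : ℝ) (μ : Measure (Ed d)) (A : ℝ → ℝ) (dt : ℝ)
    (u h : (Fin d → ℤ) → ℝ) : Prop :=
  ∀ α, Summable (fun β => Gw d dx μ α β * A (u β)) ∧
    u α - dt * ∑' β, Gw d dx μ α β * A (u β) = h α

def Fractional (d : ℕ) (μ : Measure (Ed d)) (lam clam : ℝ) : Prop :=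
  ∀ B : Set (Ed d), MeasurableSet B → B ⊆ {z : Ed d | 0 < ‖z‖ ∧ ‖z‖ < 1} →
    μ B ≤ ∫⁻ z in B, ENNReal.ofReal (clam * ‖z‖ ^ (-(d : ℝ) - lam))

def Lhat (d : ℕ) (dx : ℝ) (μ : Measure (Ed d)) (w : Ed d → ℝ) (x : Ed d) : ℝ :=
  (∫ z in {z : Ed d | dx / 2 < ‖z‖}, (w (x + z) - w x) ∂μ) +
    ∑ l : Fin d, gam d dx μ l * Dup d dx μ l w x

def Ubar (d : ℕ) (dx : ℝ) (U : (Fin d → ℤ) → ℝ) (x : Ed d) : ℝ :=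
  ∑' α : Fin d → ℤ, U α * ind d (cell d dx α) x

def cellAvg (d : ℕ) (dx : ℝ) (w : Ed d → ℝ) (x : Ed d) : ℝ :=
  ∑' α : Fin d → ℤ, Set.indicator (cell d dx α)
    (fun _ => (dx ^ d)⁻¹ * ∫ y in cell d dx α, w y) x


open scoped ENNReal

/-- An infinite real matrix with nonnegative off-diagonal entries, diagonal bounded below, and
summable columns with nonpositive sums. -/
structure IsDissipative {ι : Type*} (G : ι → ι → ℝ) : Prop where
  offDiag_nonneg : ∀ α β, α ≠ β → 0 ≤ G α β
  diag_bddBelow : ∃ C, 0 ≤ C ∧ ∀ β, -C ≤ G β β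
  summable_col : ∀ β, Summable fun α => G α β
  tsum_col_nonpos : ∀ β, ∑' α, G α β ≤ 0

namespace IsDissipative

variable {ι : Type*} {G H : ι → ι → ℝ}

lemma zero : IsDissipative (fun _ _ : ι => (0 : ℝ)) where
  offDiag_nonneg _ _ _ := le_rfl
  diag_bddBelow := ⟨0, le_rfl, fun _ => by simp⟩
  summable_col _ := summable_zero
  tsum_col_nonpos _ := by simp

lemma add (hG : IsDissipative G) (hH : IsDissipative H) :
    IsDissipative fun α β => G α β + H α β where
  offDiag_nonneg α β hab := add_nonneg (hG.offDiag_nonneg α β hab) (hH.offDiag_nonneg α β hab)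
  diag_bddBelow := by
    obtain ⟨C, hC, h1⟩ := hG.diag_bddBelow
    obtain ⟨D, hD, h2⟩ := hH.diag_bddBelow
    exact ⟨C + D, by positivity, fun β => by linarith [h1 β, h2 β]⟩
  summable_col β := (hG.summable_col β).add (hH.summable_col β)
  tsum_col_nonpos β := by
    rw [(hG.summable_col β).tsum_add (hH.summable_col β)]
    linarith [hG.tsum_col_nonpos β, hH.tsum_col_nonpos β]

lemma const_mul (hG : IsDissipative G) {c : ℝ} (hc : 0 ≤ c) :
    IsDissipative fun α β => c * G α β where
  offDiag_nonneg α β hab := mul_nonneg hc (hG.offDiag_nonneg α β hab)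
  diag_bddBelow := by
    obtain ⟨C, hC, h1⟩ := hG.diag_bddBelow
    exact ⟨c * C, by positivity, fun β => by nlinarith [mul_le_mul_of_nonneg_left (h1 β) hc]⟩
  summable_col β := (hG.summable_col β).mul_left c
  tsum_col_nonpos β := by
    rw [tsum_mul_left]
    exact mul_nonpos_of_nonneg_of_nonpos hc (hG.tsum_col_nonpos β)

lemma sum {κ : Type*} (s : Finset κ) {F : κ → ι → ι → ℝ} (hF : ∀ k ∈ s, IsDissipative (F k)) :
    IsDissipative fun α β => ∑ k ∈ s, F k α β := by
  classical
  induction s using Finset.induction_on with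
  | empty => simpa using zero
  | insert k s hk ih =>
    simp only [Finset.sum_insert hk]
    exact (hF k (by simp)).add (ih fun j hj => hF j (Finset.mem_insert_of_mem hj))

/-- The columns of a dissipative matrix are bounded in `ℓ¹`, uniformly. -/
lemma exists_tsum_abs_col_le (hG : IsDissipative G) :
    ∃ C, ∀ β, (Summable fun α => |G α β|) ∧ ∑' α, |G α β| ≤ C := by
  classical
  obtain ⟨C, hC, hdiag⟩ := hG.diag_bddBelow
  refine ⟨2 * C, fun β => ?_⟩
  have hs : HasSum (fun α => G α β + if α = β then 2 * C else 0) (∑' α, G α β + 2 * C) :=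
    (hG.summable_col β).hasSum.add (hasSum_ite_eq β (2 * C))
  have hle : ∀ α, |G α β| ≤ G α β + if α = β then 2 * C else 0 := by
    intro α
    by_cases hab : α = β
    · subst hab
      simp only [if_true]
      exact abs_le.2 ⟨by linarith [hdiag α], by linarith⟩
    · simp [hab, abs_of_nonneg (hG.offDiag_nonneg α β hab)]
  have hsum : Summable fun α => |G α β| :=
    hs.summable.of_nonneg_of_le (fun _ => abs_nonneg _) hle
  refine ⟨hsum, ?_⟩
  have := hsum.tsum_le_tsum hle hs.summable
  rw [hs.tsum_eq] at this
  linarith [hG.tsum_col_nonpos β]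

lemma summable_mul (hG : IsDissipative G) {w : ι → ℝ} (hw : Summable fun β => |w β|) :
    Summable fun p : ι × ι => G p.1 p.2 * |w p.2| := by
  obtain ⟨C, hC⟩ := hG.exists_tsum_abs_col_le
  have key : Summable fun p : ι × ι => |G p.2 p.1| * |w p.1| := by
    have h0 : 0 ≤ fun p : ι × ι => |G p.2 p.1| * |w p.1| :=
      fun p => mul_nonneg (abs_nonneg _) (abs_nonneg _)
    refine (summable_prod_of_nonneg h0).2 ⟨fun β => (hC β).1.mul_right |w β|, ?_⟩
    refine (hw.mul_left C).of_nonneg_of_le (fun β => tsum_nonneg fun α => h0 (β, α)) fun β => ?_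
    dsimp only
    rw [tsum_mul_right]
    exact mul_le_mul_of_nonneg_right (hC β).2 (abs_nonneg _)
  have := (Equiv.prodComm ι ι).summable_iff.2 key
  refine this.of_norm_bounded fun p => le_of_eq ?_
  simp only [Real.norm_eq_abs, abs_mul, abs_abs, Function.comp_apply, Equiv.prodComm_apply,
    Prod.fst_swap, Prod.snd_swap]

lemma tsum_tsum_mul_nonpos (hG : IsDissipative G) {w : ι → ℝ} (hw : Summable fun β => |w β|) :
    ∑' α, ∑' β, G α β * |w β| ≤ 0 := by
  have hcomm : ∑' α, ∑' β, G α β * |w β| = ∑' β, ∑' α, G α β * |w β| :=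
    (Summable.tsum_comm (f := fun α β => G α β * |w β|) (hG.summable_mul hw)).symm
  rw [hcomm]
  refine tsum_nonpos fun β => ?_
  rw [tsum_mul_right]
  exact mul_nonpos_of_nonpos_of_nonneg (hG.tsum_col_nonpos β) (abs_nonneg _)

/-- If `e - G w = f`, where `w` has the sign of `e`, then the `ℓ¹` norm of `e` is at most
that of `f`. -/
lemma tsum_abs_le (hG : IsDissipative G) {e w f : ι → ℝ} (he : Summable fun α => |e α|)
    (hw : Summable fun α => |w α|) (hf : Summable fun α => |f α|)
    (hsign : ∀ α, SignType.sign (e α) * w α = |w α|)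
    (heq : ∀ α, (Summable fun β => G α β * w β) ∧ e α - ∑' β, G α β * w β = f α) :
    ∑' α, |e α| ≤ ∑' α, |f α| := by
  have hprod := hG.summable_mul hw
  have hpt : ∀ α, |e α| ≤ |f α| + ∑' β, G α β * |w β| := by
    intro α
    obtain ⟨hs, h⟩ := heq α
    set s : ℝ := (SignType.sign (e α) : ℝ) with hsdef
    have hs1 : |s| ≤ 1 := by
      rcases lt_trichotomy (e α) 0 with h0 | h0 | h0 <;> simp [hsdef, h0]
    have h1 : |e α| = s * f α + ∑' β, s * (G α β * w β) := by
      rw [tsum_mul_left, ← h, hsdef, ← sign_mul_self]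
      ring
    have h2 : s * f α ≤ |f α| := by
      refine (le_abs_self _).trans ?_
      rw [abs_mul]
      exact mul_le_of_le_one_left (abs_nonneg _) hs1
    have h3 : ∑' β, s * (G α β * w β) ≤ ∑' β, G α β * |w β| := by
      refine (hs.mul_left s).tsum_le_tsum (fun β => ?_) (hprod.prod_factor α)
      by_cases hab : α = β
      · subst hab
        rw [← hsign α]
        exact le_of_eq (by ring)
      · have : s * w β ≤ |w β| := by
          refine (le_abs_self _).trans ?_
          rw [abs_mul]
          exact mul_le_of_le_one_left (abs_nonneg _) hs1
        nlinarith [mul_le_mul_of_nonneg_left this (hG.offDiag_nonneg α β hab)]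
    linarith
  have hrow : Summable fun α => ∑' β, G α β * |w β| := hprod.prod
  calc ∑' α, |e α| ≤ ∑' α, (|f α| + ∑' β, G α β * |w β|) :=
        he.tsum_le_tsum hpt (hf.add hrow)
    _ = ∑' α, |f α| + ∑' α, ∑' β, G α β * |w β| := hf.tsum_add hrow
    _ ≤ ∑' α, |f α| := by linarith [hG.tsum_tsum_mul_nonpos hw]

end IsDissipative

lemma cell_eq_preimage (d : ℕ) (dx : ℝ) (α : Fin d → ℤ) :
    cell d dx α = (WithLp.ofLp : Ed d → Fin d → ℝ) ⁻¹'
      Set.pi univ fun i => Ioo (dx * (α i : ℝ)) (dx * (α i : ℝ) + dx) := by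
  ext x
  simp [cell]

lemma measurableSet_cell (d : ℕ) (dx : ℝ) (α : Fin d → ℤ) : MeasurableSet (cell d dx α) := by
  rw [cell_eq_preimage]
  exact (PiLp.volume_preserving_ofLp (Fin d)).measurable
    (MeasurableSet.univ_pi fun _ => measurableSet_Ioo)

lemma volume_cell (d : ℕ) (dx : ℝ) (α : Fin d → ℤ) :
    volume (cell d dx α) = ENNReal.ofReal dx ^ d := by
  rw [cell_eq_preimage, (PiLp.volume_preserving_ofLp (Fin d)).measure_preimage
    (MeasurableSet.univ_pi fun _ => measurableSet_Ioo).nullMeasurableSet, Real.volume_pi_Ioo]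
  simp

lemma volume_cell_ne_top (d : ℕ) (dx : ℝ) (α : Fin d → ℤ) : volume (cell d dx α) ≠ ∞ := by
  rw [volume_cell]
  finiteness

lemma disjoint_cell {d : ℕ} {dx : ℝ} (hdx : 0 < dx) {α β : Fin d → ℤ} (hab : α ≠ β) :
    Disjoint (cell d dx α) (cell d dx β) := by
  rw [Set.disjoint_left]
  intro x hx hy
  apply hab
  funext i
  have h1 : (α i : ℝ) < β i + 1 := by
    refine lt_of_mul_lt_mul_left ?_ hdx.le
    linarith [(hx i).1, (hy i).2]
  have h2 : (β i : ℝ) < α i + 1 := by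
    refine lt_of_mul_lt_mul_left ?_ hdx.le
    linarith [(hy i).1, (hx i).2]
  have h3 : α i < β i + 1 := by exact_mod_cast h1
  have h4 : β i < α i + 1 := by exact_mod_cast h2
  omega

/-- The mass that the jump measure `ν` moves from `cell α` into `cell β`. -/
def transfer (d : ℕ) (dx : ℝ) (ν : Measure (Ed d)) (α β : Fin d → ℤ) : ℝ≥0∞ :=
  ∫⁻ x in cell d dx α, ν {z | x + z ∈ cell d dx β}

lemma measurableSet_add_mem_cell (d : ℕ) (dx : ℝ) (β : Fin d → ℤ) :
    MeasurableSet {p : Ed d × Ed d | p.1 + p.2 ∈ cell d dx β} :=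
  (measurable_fst.add measurable_snd) (measurableSet_cell d dx β)

lemma measurable_measure_add_mem_cell (d : ℕ) (dx : ℝ) (ν : Measure (Ed d)) [SFinite ν]
    (β : Fin d → ℤ) : Measurable fun x => ν {z | x + z ∈ cell d dx β} :=
  measurable_measure_prodMk_left (measurableSet_add_mem_cell d dx β)

lemma tsum_transfer_le {d : ℕ} {dx : ℝ} (hdx : 0 < dx) (ν : Measure (Ed d)) [SFinite ν]
    (β : Fin d → ℤ) :
    ∑' α, transfer d dx ν α β ≤ volume (cell d dx β) * ν univ := by
  have hfub : ∫⁻ x, ν {z | x + z ∈ cell d dx β} = volume (cell d dx β) * ν univ := by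
    have h1 := Measure.prod_apply (μ := (volume : Measure (Ed d))) (ν := ν)
      (measurableSet_add_mem_cell d dx β)
    have h2 := Measure.prod_apply_symm (μ := (volume : Measure (Ed d))) (ν := ν)
      (measurableSet_add_mem_cell d dx β)
    rw [h1] at h2
    refine h2.trans ?_
    have : ∀ z : Ed d, volume ((fun x => (x, z)) ⁻¹'
        {p : Ed d × Ed d | p.1 + p.2 ∈ cell d dx β}) = volume (cell d dx β) :=
      fun z => measure_preimage_add_right volume z _
    simp only [this, lintegral_const]
  rw [← hfub]
  unfold transfer
  rw [← lintegral_iUnion (fun α => measurableSet_cell d dx α)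
    (fun α β hab => disjoint_cell hdx hab)]
  exact setLIntegral_le_lintegral _ _

lemma integral_jump_eq {d : ℕ} {dx : ℝ} (hdx : 0 < dx) (ν : Measure (Ed d)) [IsFiniteMeasure ν]
    (α β : Fin d → ℤ) :
    ∫ x in cell d dx α, ∫ z, (ind d (cell d dx β) (x + z) - ind d (cell d dx β) x) ∂ν =
      (transfer d dx ν α β).toReal -
        if α = β then ν.real univ * volume.real (cell d dx β) else 0 := by
  have hinner : ∀ x, ∫ z, (ind d (cell d dx β) (x + z) - ind d (cell d dx β) x) ∂ν =
      ν.real {z | x + z ∈ cell d dx β} - ν.real univ * ind d (cell d dx β) x := by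
    intro x
    have hm : MeasurableSet {z | x + z ∈ cell d dx β} :=
      (measurable_const_add x) (measurableSet_cell d dx β)
    have he : (fun z => ind d (cell d dx β) (x + z)) =
        ({z | x + z ∈ cell d dx β}).indicator fun _ => (1 : ℝ) := rfl
    have hi : Integrable (fun z => ind d (cell d dx β) (x + z)) ν := by
      rw [he]
      exact (integrable_const 1).indicator hm
    rw [integral_sub hi (integrable_const _), he, integral_indicator_const _ hm]
    simp
  have hfin : IsFiniteMeasure (volume.restrict (cell d dx α)) :=
    ⟨by simpa using (volume_cell_ne_top d dx α).lt_top⟩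
  have hmeas := measurable_measure_add_mem_cell d dx ν β
  have hi1 : IntegrableOn (fun x => ν.real {z | x + z ∈ cell d dx β}) (cell d dx α) := by
    refine Integrable.of_bound hmeas.ennreal_toReal.aestronglyMeasurable (ν.real univ) ?_
    refine Filter.Eventually.of_forall fun x => ?_
    rw [Real.norm_of_nonneg measureReal_nonneg]
    exact measureReal_mono (subset_univ _)
  have hi2 : IntegrableOn (fun x => ν.real univ * ind d (cell d dx β) x) (cell d dx α) :=
    ((integrable_const (1 : ℝ)).indicator (measurableSet_cell d dx β)).const_mul _
  simp only [hinner]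
  rw [integral_sub hi1 hi2]
  congr 1
  · exact integral_toReal hmeas.aemeasurable
      (Filter.Eventually.of_forall fun x => measure_lt_top ν _)
  · rw [integral_const_mul]
    unfold ind
    rw [integral_indicator_const _ (measurableSet_cell d dx β)]
    by_cases hab : α = β
    · subst hab
      simp [measureReal_restrict_apply (measurableSet_cell d dx α)]
    · simp [measureReal_restrict_apply (measurableSet_cell d dx β), hab,
        (disjoint_cell hdx (Ne.symm hab)).inter_eq]

lemma isDissipative_jump {d : ℕ} {dx : ℝ} (hdx : 0 < dx) (ν : Measure (Ed d))
    [IsFiniteMeasure ν] :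
    IsDissipative fun α β : Fin d → ℤ => ∫ x in cell d dx α,
      ∫ z, (ind d (cell d dx β) (x + z) - ind d (cell d dx β) x) ∂ν := by
  simp only [integral_jump_eq hdx]
  have hfin : ∀ β, ∑' α, transfer d dx ν α β ≠ ∞ := fun β =>
    ((tsum_transfer_le hdx ν β).trans_lt
      (ENNReal.mul_lt_top (volume_cell_ne_top d dx β).lt_top (measure_lt_top ν _))).ne
  have hs : ∀ β, Summable fun α => (transfer d dx ν α β).toReal :=
    fun β => ENNReal.summable_toReal (hfin β)
  have hite : ∀ β : Fin d → ℤ, HasSum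
      (fun α => if α = β then ν.real univ * volume.real (cell d dx β) else 0)
      (ν.real univ * volume.real (cell d dx β)) := fun β => hasSum_ite_eq β _
  refine ⟨fun α β hab => ?_, ⟨ν.real univ * (ENNReal.ofReal dx ^ d).toReal, by positivity,
    fun β => ?_⟩, fun β => (hs β).sub (hite β).summable, fun β => ?_⟩
  · simp [hab]
  · simp [Measure.real, volume_cell]
  · rw [(hs β).tsum_sub (hite β).summable, (hite β).tsum_eq,
      ← ENNReal.tsum_toReal_eq fun α => ENNReal.ne_top_of_tsum_ne_top (hfin β) α, sub_nonpos,
      mul_comm]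
    refine (ENNReal.toReal_mono ?_ (tsum_transfer_le hdx ν β)).trans_eq ENNReal.toReal_mul
    exact (ENNReal.mul_lt_top (volume_cell_ne_top d dx β).lt_top (measure_lt_top ν _)).ne

lemma measure_lt_norm_lt_top {E : Type*} [NormedAddCommGroup E] [MeasurableSpace E]
    [OpensMeasurableSpace E] {μ : Measure E}
    (hμ : ∫⁻ z, ENNReal.ofReal (min (‖z‖ ^ 2) 1) ∂μ < ∞) {r : ℝ} (hr : 0 < r) :
    μ {z | r < ‖z‖} < ∞ := by
  have hpos : 0 < min (r ^ 2) 1 := by positivity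
  have hpos' : ENNReal.ofReal (min (r ^ 2) 1) ≠ 0 := (ENNReal.ofReal_pos.2 hpos).ne'
  have hmeas : AEMeasurable (fun z : E => ENNReal.ofReal (min (‖z‖ ^ 2) 1)) μ := by fun_prop
  refine (measure_mono ?_).trans_lt
    ((meas_ge_le_lintegral_div hmeas hpos' ENNReal.ofReal_ne_top).trans_lt
      (ENNReal.div_lt_top hμ.ne hpos'))
  intro z hz
  have hz' : r < ‖z‖ := hz
  exact ENNReal.ofReal_le_ofReal (min_le_min_right _ (by gcongr))

lemma isDissipative_Gw {d : ℕ} {dx : ℝ} (hdx : 0 < dx) {μ : Measure (Ed d)}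
    (hμ : ∫⁻ z, ENNReal.ofReal (min (‖z‖ ^ 2) 1) ∂μ < ∞) : IsDissipative (Gw d dx μ) := by
  have hfin : IsFiniteMeasure (μ.restrict {z : Ed d | dx / 2 < ‖z‖}) :=
    ⟨by simpa using measure_lt_norm_lt_top hμ (half_pos hdx)⟩
  have hc : 0 ≤ (dx ^ d)⁻¹ := by positivity
  refine ((isDissipative_jump hdx _).const_mul hc).add
    (IsDissipative.const_mul (IsDissipative.sum Finset.univ fun l _ => ?_) hc)
  by_cases hl : 0 < gam d dx μ l
  · have h := (isDissipative_jump hdx (Measure.dirac (EuclideanSpace.single l dx))).const_mul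
      (c := gam d dx μ l / dx) (by positivity)
    convert h using 3 with α β
    simp only [Dup, hl, if_true, integral_dirac, integral_div]
    ring
  · have h := (isDissipative_jump hdx (Measure.dirac (-EuclideanSpace.single l dx))).const_mul
      (c := -gam d dx μ l / dx) (div_nonneg (by linarith) hdx.le)
    convert h using 3 with α β
    have hneg : ∀ x : Ed d, ind d (cell d dx β) (x + -EuclideanSpace.single l dx) -
        ind d (cell d dx β) x = -(ind d (cell d dx β) x -
          ind d (cell d dx β) (x - EuclideanSpace.single l dx)) := by
      intro x
      rw [← sub_eq_add_neg]
      ring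
    simp only [Dup, hl, if_false, integral_dirac, integral_div, hneg, integral_neg]
    ring

lemma Monotone.sign_sub_mul_sub {A : ℝ → ℝ} (hA : Monotone A) (a b : ℝ) :
    SignType.sign (a - b) * (A a - A b) = |A a - A b| := by
  rcases lt_trichotomy a b with h | h | h
  · rw [sign_neg (sub_neg.2 h), abs_of_nonpos (sub_nonpos.2 (hA h.le))]
    simp
  · simp [h]
  · rw [sign_pos (sub_pos.2 h), abs_of_nonneg (sub_nonneg.2 (hA h.le))]
    simp

theorem stmt11 (d : ℕ) (hd : 1 ≤ d) (dx : ℝ) (hdx0 : 0 < dx) (hdx1 : dx < 1)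
    (μ : Measure (Ed d)) (hμ0 : μ {0} = 0)
    (hμfin : ∫⁻ z, ENNReal.ofReal (min (‖z‖ ^ 2) 1) ∂μ < ⊤)
    (A : ℝ → ℝ) (LA : ℝ) (hA : Aok A LA) (dt : ℝ) (hdt : 0 < dt)
    (u v h g : (Fin d → ℤ) → ℝ)
    (hu : Summable fun α => |u α|) (hv : Summable fun α => |v α|)
    (hh : Summable fun α => |h α|) (hg : Summable fun α => |g α|)
    (hstepu : SolvesImplicitStep d dx μ A dt u h)
    (hstepv : SolvesImplicitStep d dx μ A dt v g) :
    ∑' α : Fin d → ℤ, |u α - v α| ≤ ∑' α : Fin d → ℤ, |h α - g α| := by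
  obtain ⟨hmono, hlip, -⟩ := hA
  have hsub : ∀ {p q : (Fin d → ℤ) → ℝ}, (Summable fun α => |p α|) → (Summable fun α => |q α|) →
      Summable fun α => |p α - q α| := fun hp hq =>
    (hp.add hq).of_nonneg_of_le (fun _ => abs_nonneg _) fun _ => abs_sub _ _
  have he := hsub hu hv
  have hdA : Summable fun α => |A (u α) - A (v α)| :=
    (he.mul_left LA).of_nonneg_of_le (fun _ => abs_nonneg _) fun _ => hlip _ _
  refine ((isDissipative_Gw hdx0 hμfin).const_mul hdt.le).tsum_abs_le he hdA (hsub hh hg)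
    (fun α => hmono.sign_sub_mul_sub _ _) fun α => ?_
  obtain ⟨hsu, hequ⟩ := hstepu α
  obtain ⟨hsv, heqv⟩ := hstepv α
  have hrw : ∀ β, dt * Gw d dx μ α β * (A (u β) - A (v β)) =
      dt * (Gw d dx μ α β * A (u β) - Gw d dx μ α β * A (v β)) := fun β => by ring
  simp only [hrw]
  refine ⟨(hsu.sub hsv).mul_left dt, ?_⟩
  rw [tsum_mul_left, hsu.tsum_sub hsv, ← hequ, ← heqv]
  ring
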